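/- Let R be a commutative ring all of whose Pierce stalks are projective free rings, and let h ∈ R[t] be a monic polynomial of degree n ≥ 2. The following are equivalent: (1) every matrix A ∈ Mₙ(R) whose characteristic polynomial equals h is strongly π-regular; (2) there exists a matrix A ∈ Mₙ(R) whose characteristic polynomial equals h and which is strongly π-regular; (3) h has a gSP-factorization. -/

import Mathlib

/-- An element `a` of a ring is *strongly π-regular* if `a^(n+1) x = a^n` and `y a^(n+1) = a^n`
for some `n ≥ 1` and some `x`, `y`. -/
def IsStronglyPiRegular {S : Type*} [Ring S] (a : S) : Prop :=
  ∃ n : ℕ, 1 ≤ n ∧ ∃ x y : S, a ^ (n + 1) * x = a ^ n ∧ y * a ^ (n + 1) = a ^ n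

/-- A complete orthogonal set of idempotents: finitely many idempotents, pairwise orthogonal,
summing to `1`. -/
def IsCompleteOrthogonalIdempotents {R : Type*} [CommRing R] {k : ℕ} (e : Fin k → R) : Prop :=
  (∀ i, IsIdempotentElem (e i)) ∧ (∀ i j, i ≠ j → e i * e j = 0) ∧ ∑ i, e i = 1

/-- An SP-factorization of a monic polynomial `h` is a factorization `h = h₀ * p₀` into monic
polynomials with `h₀(0)` a unit and all coefficients of `p₀ - t^(deg p₀)` nilpotent. -/
def HasSPFactorization {R : Type*} [CommRing R] (h : Polynomial R) : Prop :=
  ∃ h₀ p₀ : Polynomial R, h₀.Monic ∧ p₀.Monic ∧ h = h₀ * p₀ ∧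
    IsUnit (h₀.eval 0) ∧ ∀ i, IsNilpotent ((p₀ - Polynomial.X ^ p₀.natDegree).coeff i)

/-- A monic `h ∈ R[t]` has a gSP-factorization if there is a complete orthogonal set of
idempotents `e₁, …, e_k` such that the image of `h` in `(R/(1-eᵢ))[t]` has an SP-factorization
for each `i`. -/
def HasGSPFactorization {R : Type*} [CommRing R] (h : Polynomial R) : Prop :=
  ∃ (k : ℕ) (e : Fin k → R), IsCompleteOrthogonalIdempotents e ∧
    ∀ i, HasSPFactorization (h.map (Ideal.Quotient.mk (Ideal.span {1 - e i})))

/-- The ideal of `R` generated by the idempotents of `R` lying in `p`; the Pierce stalk of `R`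
at the prime `p` is `R ⧸ pierceIdeal p`. -/
def pierceIdeal {R : Type*} [CommRing R] (p : Ideal R) : Ideal R :=
  Ideal.span {e : R | IsIdempotentElem e ∧ e ∈ p}

universe u

/-- A commutative ring is *projective free* if every finitely generated projective module over
it is free. -/
def IsProjectiveFree (S : Type u) [CommRing S] : Prop :=
  ∀ (M : Type u) [AddCommGroup M] [Module S M],
    Module.Finite S M → Module.Projective S M → Module.Free S M

open Polynomial Matrix

/-- The strong π-regularity of the class of `X` modulo `h`, witnessed by a polynomial. -/
def IsStronglyPiRegularModulo {R : Type*} [CommRing R] (h : R[X]) : Prop :=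
  ∃ (N : ℕ) (g : R[X]), h ∣ X ^ N - X ^ (N + 1) * g

theorem HasSPFactorization.isStronglyPiRegularModulo {R : Type*} [CommRing R] {h : R[X]}
    (hh : HasSPFactorization h) : IsStronglyPiRegularModulo h := by
  obtain ⟨h₀, p₀, -, -, rfl, hu, hnil⟩ := hh
  obtain ⟨M, hM⟩ := Polynomial.isNilpotent_iff.mpr hnil
  have hdvd : p₀ ∣ X ^ (p₀.natDegree * M) := by
    have h1 := sub_dvd_pow_sub_pow (p₀ - X ^ p₀.natDegree) (-(X ^ p₀.natDegree)) M
    rw [hM, zero_sub, sub_neg_eq_add, sub_add_cancel, dvd_neg, neg_pow, ← pow_mul] at h1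
    exact (IsUnit.dvd_mul_left ((isUnit_one.neg).pow M)).mp h1
  obtain ⟨q, hq⟩ := hdvd
  obtain ⟨u, hu⟩ := hu
  have hsplit : h₀ = X * h₀.divX + C (u : R) := by
    rw [hu, ← coeff_zero_eq_eval_zero, X_mul_divX_add]
  have hC : C (u : R) * C ((u⁻¹ : Rˣ) : R) = 1 := by rw [← C_mul, Units.mul_inv, C_1]
  refine ⟨p₀.natDegree * M, -(C ((u⁻¹ : Rˣ) : R) * h₀.divX), q * C ((u⁻¹ : Rˣ) : R), ?_⟩
  rw [pow_succ, hq]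
  linear_combination (-(p₀ * q)) * hC - p₀ * q * C ((u⁻¹ : Rˣ) : R) * hsplit

theorem Polynomial.C_mul_eq_zero_of_map_mk_eq_zero {R : Type*} [CommRing R] {e : R}
    (he : IsIdempotentElem e) {p : R[X]}
    (hp : p.map (Ideal.Quotient.mk (Ideal.span {1 - e})) = 0) : C e * p = 0 := by
  ext i
  have hi := congrArg (fun q => q.coeff i) hp
  simp only [coeff_map, coeff_zero] at hi
  obtain ⟨c, hc⟩ := Ideal.mem_span_singleton.mp (Ideal.Quotient.eq_zero_iff_mem.mp hi)
  rw [coeff_C_mul, hc, ← mul_assoc, he.mul_one_sub_self, zero_mul, coeff_zero]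

theorem HasGSPFactorization.isStronglyPiRegularModulo {R : Type*} [CommRing R] {h : R[X]}
    (hh : HasGSPFactorization h) : IsStronglyPiRegularModulo h := by
  obtain ⟨k, e, ⟨hid, -, hsum⟩, hsp⟩ := hh
  have key : ∀ i, ∃ (N : ℕ) (g : R[X]), h ∣ C (e i) * (X ^ N - X ^ (N + 1) * g) := by
    intro i
    obtain ⟨N, g, w, hw⟩ := (hsp i).isStronglyPiRegularModulo
    obtain ⟨g, rfl⟩ := Polynomial.map_surjective _ Ideal.Quotient.mk_surjective g
    obtain ⟨w, rfl⟩ := Polynomial.map_surjective _ Ideal.Quotient.mk_surjective w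
    refine ⟨N, g, C (e i) * w, ?_⟩
    have := C_mul_eq_zero_of_map_mk_eq_zero (hid i)
      (p := X ^ N - X ^ (N + 1) * g - h * w) (by simpa [sub_eq_zero] using hw)
    linear_combination this
  choose N g hdvd using key
  have hle : ∀ i, N i ≤ ∑ i, N i := fun i =>
    Finset.single_le_sum (f := N) (fun _ _ => Nat.zero_le _) (Finset.mem_univ i)
  refine ⟨∑ i, N i, ∑ i, C (e i) * g i, ?_⟩
  have hone : ∑ i, C (e i) = (1 : R[X]) := by rw [← map_sum, hsum, C_1]
  have hexp : (X ^ (∑ i, N i) - X ^ (∑ i, N i + 1) * ∑ i, C (e i) * g i : R[X]) =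
      ∑ i, X ^ (∑ i, N i - N i) * (C (e i) * (X ^ N i - X ^ (N i + 1) * g i)) := by
    calc _ = (∑ i, C (e i)) * X ^ (∑ i, N i) -
          X ^ (∑ i, N i + 1) * ∑ i, C (e i) * g i := by rw [hone, one_mul]
      _ = ∑ i, (C (e i) * X ^ (∑ i, N i) - X ^ (∑ i, N i + 1) * (C (e i) * g i)) := by
        rw [Finset.sum_mul, Finset.mul_sum, Finset.sum_sub_distrib]
      _ = _ := Finset.sum_congr rfl fun i _ => by
        have hX : (X ^ (∑ i, N i) : R[X]) = X ^ (∑ i, N i - N i) * X ^ N i := by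
          rw [← pow_add, Nat.sub_add_cancel (hle i)]
        rw [pow_succ, hX]
        ring
  rw [hexp]
  exact Finset.dvd_sum fun i _ => (hdvd i).mul_left _

theorem IsStronglyPiRegularModulo.isStronglyPiRegular {R S : Type*} [CommRing R] [Ring S]
    [Algebra R S] {h : R[X]} (hh : IsStronglyPiRegularModulo h) {a : S} (ha : aeval a h = 0) :
    IsStronglyPiRegular a := by
  obtain ⟨N, g, w, hw⟩ := hh
  have hX : (X ^ (N + 1 + 1) * g - X ^ (N + 1) : R[X]) = h * (-(X * w)) := by
    linear_combination (-X) * hw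
  have hz : a ^ (N + 1 + 1) * aeval a g = a ^ (N + 1) := by
    have := congrArg (aeval a) hX
    rw [map_mul, ha, zero_mul] at this
    simpa [sub_eq_zero] using this
  refine ⟨N + 1, by omega, aeval a g, aeval a g, hz, ?_⟩
  have hcomm := (Commute.all g (X ^ (N + 1 + 1))).map (aeval a)
  rw [map_pow, aeval_X] at hcomm
  exact hcomm.eq.trans hz

theorem Polynomial.Monic.exists_matrix_charpoly_eq {R : Type*} [CommRing R] [Nontrivial R]
    {h : R[X]} (hh : h.Monic) :
    ∃ A : Matrix (Fin h.natDegree) (Fin h.natDegree) R, A.charpoly = h := by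
  let pb := AdjoinRoot.powerBasis' hh
  refine ⟨Algebra.leftMulMatrix pb.basis pb.gen, ?_⟩
  have hmin := charpoly_leftMulMatrix pb
  have hdvd : h ∣ (Algebra.leftMulMatrix pb.basis pb.gen).charpoly := by
    rw [hmin, ← AdjoinRoot.mk_eq_zero, ← AdjoinRoot.aeval_eq]
    exact minpoly.aeval R pb.gen
  refine (eq_of_monic_of_dvd_of_natDegree_le hh (charpoly_monic _) hdvd ?_)
  exact ((charpoly_natDegree_eq_dim _).trans (Fintype.card_fin pb.dim)).le

/-- Fitting decomposition of a strongly π-regular element. -/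
theorem IsStronglyPiRegular.exists_idempotent {S : Type*} [Ring S] {a : S}
    (ha : IsStronglyPiRegular a) :
    ∃ E w : S, IsIdempotentElem E ∧ Commute a E ∧ a * w = E ∧ IsNilpotent (a * (1 - E)) := by
  obtain ⟨k, hk, x, y, hx, hy⟩ := ha
  have hxs : ∀ m, a ^ (k + m) * x ^ m = a ^ k := by
    intro m
    induction m with
    | zero => simp
    | succ m ih =>
      rw [show k + (m + 1) = m + (k + 1) by ring, pow_add, pow_succ' x, mul_assoc,
        ← mul_assoc _ x, hx, ← mul_assoc, ← pow_add, add_comm m, ih]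
  have hys : ∀ m, y ^ m * a ^ (k + m) = a ^ k := by
    intro m
    induction m with
    | zero => simp
    | succ m ih =>
      rw [show k + (m + 1) = (k + 1) + m by ring, pow_add _ (k + 1), pow_succ y, mul_assoc,
        ← mul_assoc y, hy, ← pow_add, ih]
  set b := a ^ k with hb
  set u := x ^ k
  set v := y ^ k
  have hu : b * b * u = b := by rw [hb, ← pow_add]; exact hxs k
  have hv : v * (b * b) = b := by rw [hb, ← pow_add]; exact hys k
  have hE : v * b = b * u := by
    calc v * b = v * (b * b * u) := by rw [hu]
      _ = v * (b * b) * u := by simp only [mul_assoc]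
      _ = b * u := by rw [hv]
  have hbE : b * (b * u) = b := by rw [← mul_assoc, hu]
  have hEb : b * u * b = b := by rw [← hE, mul_assoc, hv]
  have hab : a * b = b * a := by rw [hb, ← pow_succ, ← pow_succ']
  have hEid : b * u * (b * u) = b * u := by rw [← mul_assoc, hEb]
  have hl : b * u * a = b * u * a * (b * u) := by
    calc b * u * a = v * (b * a) := by rw [← hE, mul_assoc]
      _ = v * (a * (b * (b * u))) := by rw [hbE, hab]
      _ = v * (a * b) * (b * u) := by simp only [mul_assoc]
      _ = v * b * a * (b * u) := by rw [hab]; simp only [mul_assoc]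
      _ = _ := by rw [hE]
  have hr : a * (b * u) = b * u * a * (b * u) := by
    calc a * (b * u) = b * a * u := by rw [← mul_assoc, hab]
      _ = b * u * b * a * u := by rw [hEb]
      _ = b * u * (b * a) * u := by simp only [mul_assoc]
      _ = _ := by rw [← hab]; simp only [mul_assoc]
  have hcomm : Commute a (b * u) := hr.trans hl.symm
  refine ⟨b * u, a ^ (k - 1) * u, hEid, hcomm, ?_, k, ?_⟩
  · rw [← mul_assoc, ← pow_succ', Nat.sub_add_cancel hk]
  · rw [((Commute.one_right a).sub_right hcomm).mul_pow, ← hb]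
    obtain ⟨k, rfl⟩ := Nat.exists_eq_add_of_le' hk
    rw [pow_succ' (1 - b * u), ← mul_assoc, mul_sub, mul_one, hbE, sub_self, zero_mul]

/-- The rank polynomial `det (X E + (1 - E))` of an idempotent matrix `E`. -/
noncomputable def Matrix.rankPoly {ι R : Type*} [Fintype ι] [DecidableEq ι] [CommRing R]
    (E : Matrix ι ι R) : R[X] :=
  ((X : R[X]) • E.map C + (1 - E).map C).det

section RankPoly

variable {ι R : Type*} [Fintype ι] [DecidableEq ι] [CommRing R] (E : Matrix ι ι R)

theorem Matrix.eval₂_rankPoly {S : Type*} [CommRing S] (f : R →+* S) (s : S) :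
    E.rankPoly.eval₂ f s = (s • E.map f + (1 - E).map f).det := by
  rw [rankPoly, ← coe_eval₂RingHom, RingHom.map_det]
  congr 1
  ext i j
  simp
  ring

variable {E}

theorem IsIdempotentElem.smul_add_mul_smul_add {A S : Type*} [CommRing S] [Ring A] [Algebra S A]
    {E : A} (hE : IsIdempotentElem E) (s t : S) :
    (s • E + (1 - E)) * (t • E + (1 - E)) = (s * t) • E + (1 - E) := by
  simp only [add_mul, mul_add, smul_mul_assoc, mul_smul_comm, hE.eq, hE.mul_one_sub_self,
    hE.one_sub_mul_self, hE.one_sub.eq, smul_zero, add_zero, zero_add, smul_smul]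
  rw [mul_comm t s]

theorem IsIdempotentElem.smul_sub_add_mul_eq {A S : Type*} [CommRing S] [Ring A] [Algebra S A]
    {E a : A} (hE : IsIdempotentElem E) (ha : Commute a E) (s : S) :
    (s • E - a * E + (1 - E)) * (E + s • (1 - E) - a * (1 - E)) = s • 1 - a := by
  have hG : Commute a (1 - E) := (Commute.one_right a).sub_right ha
  have h1 : E * (a * (1 - E)) = 0 := by rw [hG.eq, ← mul_assoc, hE.mul_one_sub_self, zero_mul]
  have h2 : (1 - E) * (a * (1 - E)) = a * (1 - E) := by rw [hG.eq, ← mul_assoc, hE.one_sub.eq]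
  calc _ = (s • E - a * E) + (s • (1 - E) - a * (1 - E)) := by
        rw [add_mul, sub_mul, mul_sub, mul_sub (a * E), mul_sub (1 - E), mul_add, mul_add (a * E),
          mul_add (1 - E)]
        simp only [smul_mul_assoc, mul_smul_comm, mul_assoc, hE.eq, hE.mul_one_sub_self,
          hE.one_sub_mul_self, hE.one_sub.eq, h1, h2, smul_zero, mul_zero]
        abel
    _ = s • 1 - a := by rw [smul_sub, mul_sub, mul_one]; abel

theorem IsIdempotentElem.smul_add_mul_eq {A S : Type*} [CommRing S] [Ring A] [Algebra S A]
    {E a : A} (hE : IsIdempotentElem E) (ha : Commute a E) (s : S) :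
    (s • E + (1 - E)) * (E + s • (1 - E) - a * (1 - E)) = s • 1 - a * (1 - E) := by
  have hG : Commute a (1 - E) := (Commute.one_right a).sub_right ha
  have h1 : E * (a * (1 - E)) = 0 := by rw [hG.eq, ← mul_assoc, hE.mul_one_sub_self, zero_mul]
  have h2 : (1 - E) * (a * (1 - E)) = a * (1 - E) := by rw [hG.eq, ← mul_assoc, hE.one_sub.eq]
  calc _ = s • E + (s • (1 - E) - a * (1 - E)) := by
        rw [add_mul, mul_sub, mul_sub (1 - E), mul_add, mul_add (1 - E)]
        simp only [smul_mul_assoc, mul_smul_comm, hE.eq, hE.mul_one_sub_self,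
          hE.one_sub_mul_self, hE.one_sub.eq, h1, h2, smul_zero]
        abel
    _ = s • 1 - a * (1 - E) := by rw [smul_sub]; abel

theorem Matrix.map_one_sub {S : Type*} [CommRing S] (f : R →+* S) :
    (1 - E).map f = 1 - E.map f := by
  have := map_sub f.mapMatrix 1 E
  rwa [map_one] at this

theorem Matrix.eval₂_rankPoly_mul (hE : IsIdempotentElem E) {S : Type*} [CommRing S]
    (f : R →+* S) (s t : S) :
    E.rankPoly.eval₂ f s * E.rankPoly.eval₂ f t = E.rankPoly.eval₂ f (s * t) := by
  have hE' : IsIdempotentElem (E.map f) := hE.map f.mapMatrix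
  simp only [eval₂_rankPoly, map_one_sub]
  rw [← det_mul, hE'.smul_add_mul_smul_add]

theorem Matrix.rankPoly_mul_C_coeff (hE : IsIdempotentElem E) (i : ℕ) :
    E.rankPoly * C (E.rankPoly.coeff i) = C (E.rankPoly.coeff i) * X ^ i := by
  have h := eval₂_rankPoly_mul hE ((C : R[X] →+* R[X][X]).comp C) (C X) X
  have h1 : E.rankPoly.eval₂ ((C : R[X] →+* R[X][X]).comp C) (C X) = C E.rankPoly := by
    rw [← hom_eval₂, eval₂_C_X]
  have h2 : E.rankPoly.eval₂ ((C : R[X] →+* R[X][X]).comp C) X = E.rankPoly.map C := by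
    rw [← eval₂_map, eval₂_C_X]
  have h3 : (E.rankPoly.eval₂ ((C : R[X] →+* R[X][X]).comp C) (C X * X)).coeff i =
      C (E.rankPoly.coeff i) * X ^ i := by
    rw [eval₂_eq_sum_range, finsetSum_coeff]
    simp only [RingHom.comp_apply, mul_pow, ← C_pow, ← mul_assoc, ← C_mul, coeff_C_mul_X_pow]
    rw [Finset.sum_ite_eq]
    split_ifs with hi
    · rfl
    · rw [coeff_eq_zero_of_natDegree_lt (by simpa using hi), C_0, zero_mul]
  rw [h1, h2] at h
  rw [← h3, ← h, coeff_C_mul, coeff_map]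

theorem Matrix.isCompleteOrthogonalIdempotents_coeff_rankPoly (hE : IsIdempotentElem E) :
    IsCompleteOrthogonalIdempotents
      (fun i : Fin (Fintype.card ι + 1) => E.rankPoly.coeff i) := by
  have hmul : ∀ i j : ℕ, E.rankPoly.coeff j * E.rankPoly.coeff i =
      if j = i then E.rankPoly.coeff i else 0 := by
    intro i j
    rw [← coeff_mul_C, rankPoly_mul_C_coeff hE, coeff_C_mul_X_pow]
  refine ⟨fun i => by simp [IsIdempotentElem, hmul], fun i j hij => ?_, ?_⟩
  · rw [hmul, if_neg (fun h => hij (Fin.ext h))]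
  · have hdeg : E.rankPoly.natDegree < Fintype.card ι + 1 :=
      Nat.lt_succ_of_le (natDegree_det_X_add_C_le E (1 - E))
    have h1 : E.rankPoly.eval₂ (RingHom.id R) 1 = 1 := by
      rw [eval₂_rankPoly]
      simp [Matrix.map_id]
    rw [eval₂_eq_sum_range' _ hdeg] at h1
    rw [Fin.sum_univ_eq_sum_range (fun i => E.rankPoly.coeff i)]
    simpa using h1

theorem Matrix.rankPoly_map {S : Type*} [CommRing S] (f : R →+* S) :
    (E.map f).rankPoly = E.rankPoly.map f := by
  have h : E.rankPoly.map f = E.rankPoly.eval₂ (C.comp f) X := by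
    rw [← eval₂_map, eval₂_C_X]
  rw [h, eval₂_rankPoly, rankPoly, ← map_one_sub]
  simp only [Matrix.map_map]
  rfl

theorem Matrix.hasSPFactorization_charpoly (hE : IsIdempotentElem E) {A w : Matrix ι ι R}
    (hcomm : Commute A E) (hw : A * w = E) (hnil : IsNilpotent (A * (1 - E))) {r : ℕ}
    (hr : E.rankPoly = X ^ r) : HasSPFactorization A.charpoly := by
  set F : Matrix ι ι R[X] := E.map C with hFdef
  set B : Matrix ι ι R[X] := A.map C with hBdef
  have hF : IsIdempotentElem F := hE.map (C : R →+* R[X]).mapMatrix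
  have hBF : Commute B F := hcomm.map (C : R →+* R[X]).mapMatrix
  have hchar : ∀ M : Matrix ι ι R, M.charpoly = ((X : R[X]) • 1 - M.map C).det := by
    intro M
    rw [Matrix.charpoly, charmatrix]
    congr 2
    simp [Matrix.smul_one_eq_diagonal]
  set g₀ : R[X] := ((X : R[X]) • F - B * F + (1 - F)).det with hg₀
  set g₁ : R[X] := (F + (X : R[X]) • (1 - F) - B * (1 - F)).det with hg₁
  have hprod : A.charpoly = g₀ * g₁ := by
    rw [hg₀, hg₁, ← det_mul, hchar]
    congr 1
    exact (hF.smul_sub_add_mul_eq hBF X).symm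
  have hN : (A * (1 - E)).map C = B * (1 - F) := by
    rw [Matrix.map_mul, map_one_sub]
  have hprod₁ : X ^ r * g₁ = (A * (1 - E)).charpoly := by
    rw [← hr, rankPoly, map_one_sub, hg₁, ← det_mul, hchar, hN, ← hFdef]
    congr 1
    exact hF.smul_add_mul_eq hBF X
  have hm₁ : g₁.Monic := (monic_X_pow r).of_mul_monic_left (hprod₁ ▸ charpoly_monic _)
  have hm₀ : g₀.Monic := hm₁.of_mul_monic_right (hprod ▸ charpoly_monic _)
  refine ⟨g₀, g₁, hm₀, hm₁, hprod, ?_, fun i => ?_⟩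
  · have heval : g₀.eval 0 = (-(A * E) + (1 - E)).det := by
      rw [hg₀, ← coe_evalRingHom, RingHom.map_det, hFdef, hBdef, ← Matrix.map_mul,
        ← map_one_sub]
      congr 1
      ext i j
      simp [-Matrix.map_mul]
    rw [heval]
    refine IsUnit.of_mul_eq_one (-(E * w * E) + (1 - E)).det ?_
    have hEE : ∀ M, E * (E * M) = E * M := fun M => by rw [← mul_assoc, hE.eq]
    have h1 : A * E * (E * w * E) = E := by
      rw [show A * E * (E * w * E) = A * E * E * w * E by simp only [mul_assoc],
        mul_assoc A E E, hE.eq, hcomm.eq, mul_assoc E A w, hw, hE.eq, hE.eq]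
    have h2 : A * E * (1 - E) = 0 := by rw [mul_assoc, hE.mul_one_sub_self, mul_zero]
    have h3 : (1 - E) * (E * w * E) = 0 := by
      rw [mul_assoc, ← mul_assoc, hE.one_sub_mul_self, zero_mul]
    rw [← det_mul, add_mul, mul_add, mul_add, neg_mul_neg, neg_mul, mul_neg, h1, h2, h3,
      hE.one_sub.eq]
    simp
  · nontriviality R
    have hdeg : r + g₁.natDegree = Fintype.card ι := by
      rw [← charpoly_natDegree_eq_dim (A * (1 - E)), ← hprod₁,
        (monic_X_pow r).natDegree_mul hm₁, natDegree_X_pow]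
    have h := isNilpotent_charpoly_sub_pow_of_isNilpotent hnil
    rw [← hprod₁, ← hdeg, pow_add, ← mul_sub] at h
    have h' := Polynomial.isNilpotent_iff.mp h (i + r)
    rwa [coeff_X_pow_mul] at h'

end RankPoly

theorem Matrix.hasGSPFactorization_charpoly {ι R : Type*} [Fintype ι] [DecidableEq ι] [CommRing R]
    {A : Matrix ι ι R} (hA : IsStronglyPiRegular A) : HasGSPFactorization A.charpoly := by
  obtain ⟨E, w, hE, hcomm, hw, hnil⟩ := hA.exists_idempotent
  refine ⟨_, _, isCompleteOrthogonalIdempotents_coeff_rankPoly hE, fun i => ?_⟩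
  set q := Ideal.Quotient.mk (Ideal.span {1 - E.rankPoly.coeff i}) with hq
  have hone : q (E.rankPoly.coeff i) = 1 := by
    have : q (1 - E.rankPoly.coeff i) = 0 :=
      Ideal.Quotient.eq_zero_iff_mem.mpr (Ideal.mem_span_singleton_self _)
    rw [map_sub, map_one, sub_eq_zero] at this
    exact this.symm
  rw [← charpoly_map]
  have hN : q.mapMatrix (A * (1 - E)) = q.mapMatrix A * (1 - q.mapMatrix E) := by
    rw [map_mul, map_sub, map_one]
  refine hasSPFactorization_charpoly (E := q.mapMatrix E) (w := q.mapMatrix w) (r := i)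
    (hE.map q.mapMatrix) (hcomm.map q.mapMatrix) ?_ (hN ▸ hnil.map q.mapMatrix) ?_
  · exact (map_mul q.mapMatrix A w).symm.trans (congrArg _ hw)
  · have h := congrArg (Polynomial.map q) (rankPoly_mul_C_coeff hE i)
    rw [Polynomial.map_mul, Polynomial.map_mul, Polynomial.map_pow, map_C, map_X, hone, C_1,
      mul_one, one_mul] at h
    exact (rankPoly_map q).trans h

/-- If all Pierce stalks of the commutative ring `R` are projective free, then for a monic
`h` of degree `n ≥ 2` the following are equivalent: every matrix with characteristic
polynomial `h` is strongly π-regular; some matrix with characteristic polynomial `h` is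
strongly π-regular; `h` has a gSP-factorization. -/
theorem stronglyPiRegular_tfae_of_pierceStalks_projectiveFree {R : Type u} [CommRing R]
    (hR : ∀ p : Ideal R, p.IsPrime → IsProjectiveFree (R ⧸ pierceIdeal p))
    {n : ℕ} (hn : 2 ≤ n) (h : Polynomial R) (hmonic : h.Monic) (hdeg : h.natDegree = n) :
    List.TFAE
      [∀ A : Matrix (Fin n) (Fin n) R, A.charpoly = h → IsStronglyPiRegular A,
       ∃ A : Matrix (Fin n) (Fin n) R, A.charpoly = h ∧ IsStronglyPiRegular A,
       HasGSPFactorization h] := by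
  have : Nontrivial R := by
    by_contra hc
    rw [not_nontrivial_iff_subsingleton] at hc
    rw [Subsingleton.elim h 0, Polynomial.natDegree_zero] at hdeg
    omega
  tfae_have 1 → 2 := fun H => by
    subst hdeg
    obtain ⟨A, hA⟩ := hmonic.exists_matrix_charpoly_eq
    exact ⟨A, hA, H A hA⟩
  tfae_have 2 → 3 := by
    rintro ⟨A, rfl, hA⟩
    exact hasGSPFactorization_charpoly hA
  tfae_have 3 → 1 := by
    intro H A hA
    refine H.isStronglyPiRegularModulo.isStronglyPiRegular ?_
    rw [← hA]
    exact aeval_self_charpoly A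
  tfae_finish
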